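/- If I and J are power-closed ideals of R = ℂ[x_1,…,x_d], then the product ideal IJ is power-closed; in particular, I^n is power-closed for every n ∈ ℕ. -/

import Mathlib

open MvPolynomial

/-- The substitution `x_j ↦ x_j^i`. -/
noncomputable def pw (d i : ℕ) (f : MvPolynomial (Fin d) ℂ) : MvPolynomial (Fin d) ℂ :=
  aeval (fun j => X j ^ i) f

/-- An ideal is power-closed if it is closed under all the substitutions `x_j ↦ x_j^i`. -/
def PowerClosed {d : ℕ} (J : Ideal (MvPolynomial (Fin d) ℂ)) : Prop :=
  ∀ f ∈ J, ∀ i : ℕ, 0 < i → pw d i f ∈ J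

theorem PowerClosed.mul {d : ℕ} {I J : Ideal (MvPolynomial (Fin d) ℂ)}
    (hI : PowerClosed I) (hJ : PowerClosed J) : PowerClosed (I * J) := by
  intro f hf i hi
  refine Submodule.mul_induction_on hf (fun a ha b hb => ?_) (fun a b ha hb => ?_)
  · simpa only [pw, map_mul] using Ideal.mul_mem_mul (hI a ha i hi) (hJ b hb i hi)
  · simpa only [pw, map_add] using Ideal.add_mem _ ha hb

theorem powerClosed_top {d : ℕ} : PowerClosed (⊤ : Ideal (MvPolynomial (Fin d) ℂ)) :=
  fun _ _ _ _ => Submodule.mem_top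

theorem PowerClosed.pow {d : ℕ} {I : Ideal (MvPolynomial (Fin d) ℂ)}
    (hI : PowerClosed I) (n : ℕ) : PowerClosed (I ^ n) := by
  induction n with
  | zero => simpa only [pow_zero, Ideal.one_eq_top] using powerClosed_top
  | succ n ih => simpa only [pow_succ] using ih.mul hI

theorem stmt3 (d : ℕ) (I J : Ideal (MvPolynomial (Fin d) ℂ))
    (hI : PowerClosed I) (hJ : PowerClosed J) :
    PowerClosed (I * J) ∧ ∀ n : ℕ, 0 < n → PowerClosed (I ^ n) :=
  ⟨hI.mul hJ, fun n _ => hI.pow n⟩
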